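/- Let F = {(f_1, g_1), …, (f_k, g_k)} (k ≥ 1) be a system of min-plus polynomials in n variables over ℝ, let d_j = max(deg f_j, deg g_j), and set N = (n+2)(d_1 + ⋯ + d_k). Then F has a root in ℝ^n if and only if the Macaulay min-plus linear system Ml_N ⊙ y = Mr_N ⊙ y of F has a solution. -/

import Mathlib

open scoped Classical

/-- Exponent vectors in `n` variables. -/
abbrev Exp (n : ℕ) : Type := Fin n → ℕ

/-- The total degree `|I|` of an exponent vector. -/
def expDeg {n : ℕ} (I : Exp n) : ℕ := ∑ j, I j

/-- A tropical polynomial: a finite nonempty support of exponent vectors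
together with real coefficients. -/
structure TropPoly (n : ℕ) where
  supp : Finset (Exp n)
  supp_nonempty : supp.Nonempty
  coeff : Exp n → ℝ

/-- The degree of a tropical polynomial. -/
def TropPoly.deg {n : ℕ} (f : TropPoly n) : ℕ := f.supp.sup expDeg

/-- Value of the monomial of `f` with exponent `I` at a point of `ℝ^n`. -/
def TropPoly.mono {n : ℕ} (f : TropPoly n) (I : Exp n) (a : Fin n → ℝ) : ℝ :=
  f.coeff I + ∑ j, (I j : ℝ) * a j

/-- Value of a tropical polynomial at a point of `ℝ^n`. -/
def TropPoly.eval {n : ℕ} (f : TropPoly n) (a : Fin n → ℝ) : ℝ :=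
  f.supp.inf' f.supp_nonempty (fun I => f.mono I a)

/-- A point of `ℝ^n` is a root if the minimum is attained at two distinct monomials. -/
def TropPoly.IsRoot {n : ℕ} (f : TropPoly n) (a : Fin n → ℝ) : Prop :=
  ∃ I ∈ f.supp, ∃ J ∈ f.supp, I ≠ J ∧
    f.mono I a = f.eval a ∧ f.mono J a = f.eval a

/-- Value of the monomial of `f` with exponent `I` at a point of `ℝ∞^n`
(with the convention `0 • ⊤ = 0`). -/
noncomputable def TropPoly.monoT {n : ℕ} (f : TropPoly n) (I : Exp n)
    (a : Fin n → WithTop ℝ) : WithTop ℝ :=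
  (f.coeff I : WithTop ℝ) + ∑ j, (I j) • a j

/-- Value of a tropical polynomial at a point of `ℝ∞^n`. -/
noncomputable def TropPoly.evalT {n : ℕ} (f : TropPoly n) (a : Fin n → WithTop ℝ) : WithTop ℝ :=
  f.supp.inf (fun I => f.monoT I a)

/-- A point of `ℝ∞^n` is a root if the minimum is `+∞` or is attained at two
distinct monomials. -/
noncomputable def TropPoly.IsRootT {n : ℕ} (f : TropPoly n) (a : Fin n → WithTop ℝ) : Prop :=
  f.evalT a = ⊤ ∨ ∃ I ∈ f.supp, ∃ J ∈ f.supp, I ≠ J ∧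
    f.monoT I a = f.evalT a ∧ f.monoT J a = f.evalT a

/-- The coefficient of the monomial `x^I` in `x^J ⊙ f`, which is `+∞`
unless `I - J` belongs to the support of `f`. -/
noncomputable def shiftCoeff {n : ℕ} (f : TropPoly n) (J I : Exp n) : WithTop ℝ :=
  if J ≤ I ∧ I - J ∈ f.supp then (f.coeff (I - J) : WithTop ℝ) else ⊤

/-- The entry `c_{f}(I-J) + y_I` of the Macaulay system. -/
noncomputable def macVal {n : ℕ} (f : TropPoly n) (J : Exp n)
    (y : Exp n → WithTop ℝ) (I : Exp n) : WithTop ℝ :=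
  shiftCoeff f J I + y I

/-- The finite set of all exponent vectors of total degree at most `N`. -/
noncomputable def degLE (n N : ℕ) : Finset (Exp n) :=
  (Finset.Iic (fun _ => N : Exp n)).filter (fun I => expDeg I ≤ N)

lemma mem_degLE {n N : ℕ} (I : Exp n) : I ∈ degLE n N ↔ expDeg I ≤ N := by
  unfold degLE
  simp only [Finset.mem_filter, Finset.mem_Iic, and_iff_right_iff_imp]
  intro h
  intro j
  calc I j ≤ ∑ i, I i := Finset.single_le_sum (fun i _ => Nat.zero_le _) (Finset.mem_univ j)
  _ ≤ N := h

/-- The minimum over all `I` with `|I| ≤ N` of `c_f(I-J) + y_I`. -/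
noncomputable def macMinLE {n : ℕ} (f : TropPoly n) (J : Exp n)
    (y : Exp n → WithTop ℝ) (N : ℕ) : WithTop ℝ :=
  (degLE n N).inf (fun I => macVal f J y I)

/-- `y` is a solution of the Macaulay min-plus linear system
`Ml_N ⊙ y = Mr_N ⊙ y` of the min-plus system `F` over `ℝ`. -/
noncomputable def IsMPMacaulaySol {n k : ℕ} (F : Fin k → TropPoly n × TropPoly n) (N : ℕ)
    (y : Exp n → ℝ) : Prop :=
  ∀ j : Fin k, ∀ J : Exp n, expDeg J + max (F j).1.deg (F j).2.deg ≤ N →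
    macMinLE (F j).1 J (fun I => (y I : WithTop ℝ)) N =
      macMinLE (F j).2 J (fun I => (y I : WithTop ℝ)) N


/-- The Farkas lemma for finitely many linear functionals. -/
lemma farkas_aux {V : Type*} [AddCommGroup V] [Module ℝ V] (m : ℕ) :
    ∀ (A : Fin m → V →ₗ[ℝ] ℝ) (b : V →ₗ[ℝ] ℝ),
      (∀ x, (∀ i, A i x ≤ 0) → b x ≤ 0) →
      ∃ l : Fin m → ℝ, (∀ i, 0 ≤ l i) ∧ ∀ x, b x = ∑ i, l i * A i x := by
  induction m with
  | zero =>
    intro A b h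
    refine ⟨fun _ => 0, fun _ => le_rfl, fun x => ?_⟩
    have h1 := h x (fun i => i.elim0)
    have h2 := h (-x) (fun i => i.elim0)
    rw [map_neg] at h2
    simp only [Finset.univ_eq_empty, Finset.sum_empty]
    linarith
  | succ m ih =>
    intro A b h
    by_cases hc : ∀ x, (∀ i : Fin m, A i.succ x ≤ 0) → b x ≤ 0
    · obtain ⟨l, hl, hb⟩ := ih (fun i => A i.succ) b hc
      refine ⟨Fin.cons 0 l, ?_, fun x => ?_⟩
      · intro i
        refine Fin.cases ?_ (fun i => ?_) i
        · simp
        · simpa using hl i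
      · rw [Fin.sum_univ_succ, hb x]
        simp
    · push Not at hc
      obtain ⟨x1, hx1, hbx1⟩ := hc
      have hA1 : 0 < A 0 x1 := by
        by_contra hn
        refine absurd (h x1 (fun i => ?_)) (not_le.mpr hbx1)
        refine Fin.cases ?_ (fun i => ?_) i
        · exact not_lt.mp hn
        · exact hx1 i
      obtain ⟨x0, hx0, hbx0, hA0⟩ : ∃ x0, (∀ i : Fin m, A i.succ x0 ≤ 0) ∧ 0 < b x0 ∧
          A 0 x0 = 1 := by
        refine ⟨(A 0 x1)⁻¹ • x1, fun i => ?_, ?_, ?_⟩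
        · rw [map_smul, smul_eq_mul]
          exact mul_nonpos_of_nonneg_of_nonpos (by positivity) (hx1 i)
        · rw [map_smul, smul_eq_mul]; positivity
        · rw [map_smul, smul_eq_mul]; field_simp
      obtain ⟨l, hl, hb⟩ := ih (fun i => A i.succ - (A i.succ x0) • A 0) (b - (b x0) • A 0) (by
        intro x hx
        have := h (x - (A 0 x) • x0) (fun i => by
          refine Fin.cases ?_ (fun i => ?_) i
          · simp [hA0]
          · have := hx i
            simp at this ⊢
            linarith)
        simp at this ⊢
        linarith)
      refine ⟨Fin.cons (b x0 - ∑ i, l i * A i.succ x0) l, ?_, fun x => ?_⟩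
      · intro i
        refine Fin.cases ?_ (fun i => ?_) i
        · simp only [Fin.cons_zero]
          have : ∑ i, l i * A i.succ x0 ≤ 0 :=
            Finset.sum_nonpos fun i _ => mul_nonpos_of_nonneg_of_nonpos (hl i) (hx0 i)
          linarith
        · simpa using hl i
      · have := hb x
        simp only [LinearMap.sub_apply, LinearMap.smul_apply, smul_eq_mul, mul_sub,
          Finset.sum_sub_distrib] at this
        rw [Fin.sum_univ_succ]
        simp only [Fin.cons_zero, Fin.cons_succ]
        have h3 : ∑ i, l i * (A i.succ x0 * A 0 x) = (∑ i, l i * A i.succ x0) * A 0 x := by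
          rw [Finset.sum_mul]
          exact Finset.sum_congr rfl fun i _ => by ring
        rw [h3] at this
        linarith

lemma farkas {V ι : Type*} [Fintype ι] [AddCommGroup V] [Module ℝ V]
    (A : ι → V →ₗ[ℝ] ℝ) (b : V →ₗ[ℝ] ℝ)
    (h : ∀ x, (∀ i, A i x ≤ 0) → b x ≤ 0) :
    ∃ l : ι → ℝ, (∀ i, 0 ≤ l i) ∧ ∀ x, b x = ∑ i, l i * A i x := by
  let e := Fintype.equivFin ι
  obtain ⟨l, hl, hb⟩ := farkas_aux (Fintype.card ι) (fun i => A (e.symm i)) b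
    (fun x hx => h x fun i => by simpa using hx (e i))
  refine ⟨fun i => l (e i), fun i => hl _, fun x => ?_⟩
  rw [hb x]
  exact (Fintype.sum_equiv e _ _ (fun i => by simp)).symm

/-- The functional `(a, κ, r) ↦ r c + ⟨e, a⟩ - κ`. -/
noncomputable def lpFun {n : ℕ} (e : Fin n → ℝ) (c : ℝ) : ((Fin n → ℝ) × ℝ × ℝ) →ₗ[ℝ] ℝ where
  toFun x := x.2.2 * c + ∑ j, e j * x.1 j - x.2.1
  map_add' x y := by
    simp only [Prod.fst_add, Prod.snd_add, Pi.add_apply, mul_add, Finset.sum_add_distrib]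
    ring
  map_smul' r x := by
    simp only [Prod.smul_fst, Prod.smul_snd, Pi.smul_apply, smul_eq_mul, RingHom.id_apply]
    have : ∑ j, e j * (r * x.1 j) = r * ∑ j, e j * x.1 j := by
      rw [Finset.mul_sum]; exact Finset.sum_congr rfl fun i _ => by ring
    rw [this]; ring

lemma lpFun_apply {n : ℕ} (e : Fin n → ℝ) (c : ℝ) (x : (Fin n → ℝ) × ℝ × ℝ) :
    lpFun e c x = x.2.2 * c + ∑ j, e j * x.1 j - x.2.1 := rfl

/-- Complementary slackness: an optimal weight has a dual certificate. -/
lemma exists_dual {ι : Type*} [Fintype ι] {n : ℕ} (e : ι → Fin n → ℝ) (c : ι → ℝ) (lam : ι → ℝ)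
    (h0 : ∀ t, 0 ≤ lam t)
    (hopt : ∀ mu : ι → ℝ, (∀ t, 0 ≤ mu t) → ∑ t, mu t = ∑ t, lam t →
      (∀ j, ∑ t, mu t * e t j = ∑ t, lam t * e t j) → ∑ t, lam t * c t ≤ ∑ t, mu t * c t) :
    ∃ (a : Fin n → ℝ) (κ : ℝ), (∀ t, κ ≤ c t + ∑ j, e t j * a j) ∧
      ∀ t, 0 < lam t → c t + ∑ j, e t j * a j = κ := by
  by_cases hc : ∃ x : (Fin n → ℝ) × ℝ × ℝ, (∀ t, 0 ≤ lpFun (e t) (c t) x) ∧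
      (∑ t, lam t * lpFun (e t) (c t) x ≤ 0) ∧ 0 < x.2.2
  · obtain ⟨x, h1, h2, h3⟩ := hc
    have key : ∀ t, c t + ∑ j, e t j * (x.1 j / x.2.2) = (lpFun (e t) (c t) x + x.2.1) / x.2.2 := by
      intro t
      rw [lpFun_apply]
      have : ∑ j, e t j * (x.1 j / x.2.2) = (∑ j, e t j * x.1 j) / x.2.2 := by
        rw [Finset.sum_div]; exact Finset.sum_congr rfl fun i _ => by ring
      rw [this]; field_simp; ring
    refine ⟨fun j => x.1 j / x.2.2, x.2.1 / x.2.2, fun t => ?_, fun t ht => ?_⟩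
    · rw [key]
      gcongr
      linarith [h1 t]
    · rw [key]
      have h4 : ∑ t, lam t * lpFun (e t) (c t) x = 0 :=
        le_antisymm h2 (Finset.sum_nonneg fun t _ => mul_nonneg (h0 t) (h1 t))
      rw [Finset.sum_eq_zero_iff_of_nonneg (fun t _ => mul_nonneg (h0 t) (h1 t))] at h4
      have := h4 t (Finset.mem_univ t)
      rcases mul_eq_zero.mp this with h | h
      · exact absurd h ht.ne'
      · rw [h]; ring
  · push Not at hc
    exfalso
    let B : Option ι → ((Fin n → ℝ) × ℝ × ℝ) →ₗ[ℝ] ℝ := fun o =>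
      o.elim (∑ t, lam t • lpFun (e t) (c t)) (fun t => - lpFun (e t) (c t))
    obtain ⟨l, hl, hb⟩ := farkas B
      ((LinearMap.snd ℝ ℝ ℝ).comp (LinearMap.snd ℝ (Fin n → ℝ) (ℝ × ℝ))) (by
      intro x hx
      apply hc x
      · intro t
        have := hx (some t)
        simpa [B] using this
      · have := hx none
        simpa [B, LinearMap.sum_apply] using this)
    have hb' : ∀ x : (Fin n → ℝ) × ℝ × ℝ, x.2.2 =
        ∑ t, (l none * lam t - l (some t)) * lpFun (e t) (c t) x := by
      intro x
      have := hb x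
      simp only [LinearMap.comp_apply, LinearMap.snd_apply, Fintype.sum_option, B, Option.elim,
        LinearMap.sum_apply, LinearMap.smul_apply, LinearMap.neg_apply, smul_eq_mul] at this
      rw [this, Finset.mul_sum, ← Finset.sum_add_distrib]
      exact Finset.sum_congr rfl fun i _ => by ring
    have e1 : ∑ t, (l none * lam t - l (some t)) = 0 := by
      have := hb' (0, -1, 0)
      simp [lpFun_apply] at this
      simpa using this.symm
    have e2 : ∑ t, (l none * lam t - l (some t)) * c t = 1 := by
      have := hb' (0, 0, 1)
      simp [lpFun_apply] at this
      exact this.symm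
    have e3 : ∀ j, ∑ t, (l none * lam t - l (some t)) * e t j = 0 := by
      intro j
      have := hb' (Pi.single j 1, 0, 0)
      simp [lpFun_apply, Pi.single_apply] at this
      exact this.symm
    have hn : 0 ≤ l none := hl none
    set ε : ℝ := 1 / (l none + 1) with hε
    have hεp : 0 < ε := by positivity
    have hεl : ε * l none ≤ 1 := by
      rw [hε, one_div, inv_mul_le_iff₀ (by positivity)]; linarith
    have comb : ∀ g : ι → ℝ, ∑ t, (lam t - ε * (l none * lam t - l (some t))) * g t =
        ∑ t, lam t * g t - ε * ∑ t, (l none * lam t - l (some t)) * g t := by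
      intro g
      rw [Finset.mul_sum, ← Finset.sum_sub_distrib]
      exact Finset.sum_congr rfl fun i _ => by ring
    have := hopt (fun t => lam t - ε * (l none * lam t - l (some t))) (fun t => by
      have h1 := mul_nonneg hεp.le (hl (some t))
      have h2 := mul_nonneg (sub_nonneg.mpr hεl) (h0 t)
      linarith) (by
      have := comb (fun _ => 1)
      simp only [mul_one] at this
      rw [this, e1]; ring) (fun j => by rw [comb, e3]; ring)
    rw [comb, e2] at this
    linarith

/-- Carathéodory: we can concentrate the weights so that one of them exceeds `1`. -/
lemma exists_big {ι : Type*} [Fintype ι] {n : ℕ} (e : ι → Fin n → ℝ) (lam : ι → ℝ)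
    (h0 : ∀ t, 0 ≤ lam t) (hs : ∑ t, lam t = n + 2) :
    ∃ mu : ι → ℝ, (∀ t, 0 ≤ mu t) ∧ ∑ t, mu t = n + 2 ∧
      (∀ j, ∑ t, mu t * e t j = ∑ t, lam t * e t j) ∧ (∀ t, 0 < mu t → 0 < lam t) ∧
      ∃ s, 1 < mu s := by
  classical
  have hn : (0 : ℝ) < n + 2 := by positivity
  let S : Finset ι := Finset.univ.filter fun t => 0 < lam t
  have hS : ∀ g : ι → ℝ, ∑ t ∈ S, lam t * g t = ∑ t, lam t * g t := by
    intro g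
    apply Finset.sum_subset (Finset.subset_univ _)
    intro t _ ht
    have : lam t = 0 := by
      have : ¬ 0 < lam t := by simpa [S] using ht
      linarith [h0 t]
    simp [this]
  have hx : S.centerMass lam e ∈ convexHull ℝ (e '' {t | 0 < lam t}) := by
    apply Finset.centerMass_mem_convexHull
    · exact fun t _ => h0 t
    · have := hS (fun _ => 1)
      simp only [mul_one] at this
      rw [this, hs]; exact hn
    · intro t ht
      exact ⟨t, by simpa [S] using ht, rfl⟩
  obtain ⟨κ, _, z, w, hz, hind, hw, hw1, hwx⟩ := eq_pos_convex_span_of_mem_convexHull hx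
  have hcard : Fintype.card κ ≤ n + 1 := by
    have := hind.card_le_finrank_succ
    have h2 := Submodule.finrank_le (vectorSpan ℝ (Set.range z))
    rw [Module.finrank_fin_fun] at h2
    omega
  have hz' : ∀ i, ∃ t, 0 < lam t ∧ e t = z i := fun i => by
    obtain ⟨t, ht, h⟩ := hz ⟨i, rfl⟩
    exact ⟨t, ht, h⟩
  choose p hp hpe using hz'
  let mu : ι → ℝ := fun t => ∑ i, if p i = t then (n + 2) * w i else 0
  have hmu : ∀ g : ι → ℝ, ∑ t, mu t * g t = (n + 2) * ∑ i, w i * g (p i) := by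
    intro g
    simp only [mu, Finset.sum_mul]
    rw [Finset.sum_comm, Finset.mul_sum]
    refine Finset.sum_congr rfl fun i _ => ?_
    simp only [ite_mul, zero_mul, Finset.sum_ite_eq, Finset.mem_univ, if_true]
    ring
  have hmu0 : ∀ t, 0 ≤ mu t := fun t => Finset.sum_nonneg fun i _ => by
    split_ifs
    · exact mul_nonneg hn.le (hw i).le
    · exact le_rfl
  refine ⟨mu, hmu0, ?_, ?_, ?_, ?_⟩
  · have := hmu (fun _ => 1)
    simp only [mul_one, hw1] at this
    exact this
  · intro j
    rw [hmu]
    have h1 := congrFun hwx j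
    rw [Finset.centerMass] at h1
    have hsum : ∑ t ∈ S, lam t = n + 2 := by
      have := hS (fun _ => 1)
      simp only [mul_one] at this
      rw [this, hs]
    rw [hsum] at h1
    simp only [Finset.sum_apply, Pi.smul_apply, smul_eq_mul] at h1
    rw [hS (fun t => e t j)] at h1
    simp only [hpe]
    rw [h1]
    field_simp
  · intro t ht
    by_contra hcon
    have : mu t = 0 := Finset.sum_eq_zero fun i _ => by
      rw [if_neg]
      rintro rfl
      exact hcon (hp i)
    linarith
  · have : ∃ i, 1 < (n + 2) * w i := by
      by_contra hcon
      push Not at hcon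
      have h1 : ∑ i, (n + 2) * w i ≤ ∑ i : κ, (1 : ℝ) := Finset.sum_le_sum fun i _ => hcon i
      rw [← Finset.mul_sum, hw1] at h1
      simp at h1
      have : (Fintype.card κ : ℝ) ≤ n + 1 := by exact_mod_cast hcard
      linarith
    obtain ⟨i, hi⟩ := this
    refine ⟨p i, lt_of_lt_of_le hi ?_⟩
    have := Finset.single_le_sum (f := fun i' => if p i' = p i then (n + 2) * w i' else 0)
      (fun i' _ => by
        split_ifs
        · exact mul_nonneg hn.le (hw i').le
        · exact le_rfl) (Finset.mem_univ i)
    simpa using this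

/-- Feasible fractional decompositions of the lattice point `I`. -/
def Feas {ι : Type*} [Fintype ι] {n : ℕ} (E : ι → Exp n) (lam : ι → ℝ) (I : Exp n) : Prop :=
  (∀ t, 0 ≤ lam t) ∧ ∑ t, lam t = n + 2 ∧ ∀ i, ∑ t, lam t * (E t i : ℝ) = I i

lemma feas_degLE {ι : Type*} [Fintype ι] {n D : ℕ} (E : ι → Exp n) (hE : ∀ t, expDeg (E t) ≤ D)
    {lam : ι → ℝ} {I : Exp n} (h : Feas E lam I) : expDeg I ≤ (n + 2) * D := by
  obtain ⟨h0, h1, h2⟩ := h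
  have : (expDeg I : ℝ) ≤ ((n + 2) * D : ℝ) := by
    unfold expDeg
    push_cast
    simp only [← h2]
    rw [Finset.sum_comm, ← h1, Finset.sum_mul]
    refine Finset.sum_le_sum fun t _ => ?_
    rw [← Finset.mul_sum]
    refine mul_le_mul_of_nonneg_left ?_ (h0 t)
    exact_mod_cast hE t
  exact_mod_cast this

lemma exists_opt {ι : Type*} [Fintype ι] [Nonempty ι] {n D : ℕ} (E : ι → Exp n)
    (hE : ∀ t, expDeg (E t) ≤ D) (c : ι → ℝ) (y : Exp n → ℝ) :
    ∃ lam I, Feas E lam I ∧ ∀ mu J, Feas E mu J →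
      ∑ t, lam t * c t + y I ≤ ∑ t, mu t * c t + y J := by
  classical
  have hI : ∀ I : Exp n, (∃ lam, Feas E lam I) → ∃ lam, Feas E lam I ∧
      ∀ mu, Feas E mu I → ∑ t, lam t * c t ≤ ∑ t, mu t * c t := by
    intro I hne
    have hclosed : IsClosed {lam : ι → ℝ | Feas E lam I} := by
      simp only [Feas, Set.ofPred_and, Set.ofPred_forall]
      refine IsClosed.inter (isClosed_iInter fun t => ?_) (IsClosed.inter ?_
        (isClosed_iInter fun i => ?_))
      · exact isClosed_le continuous_const (continuous_apply t)
      · exact isClosed_eq (by fun_prop) continuous_const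
      · exact isClosed_eq (by fun_prop) continuous_const
    have hcomp : IsCompact {lam : ι → ℝ | Feas E lam I} := by
      refine IsCompact.of_isClosed_subset (isCompact_Icc (a := (fun _ => 0 : ι → ℝ))
        (b := fun _ => (n : ℝ) + 2)) hclosed ?_
      rintro lam ⟨h0, h1, -⟩
      refine ⟨fun t => h0 t, fun t => ?_⟩
      rw [← h1]
      exact Finset.single_le_sum (f := lam) (fun i _ => h0 i) (Finset.mem_univ t)
    obtain ⟨lam, hl, hm⟩ := hcomp.exists_isMinOn hne
      (f := fun lam => ∑ t, lam t * c t) (by fun_prop)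
    exact ⟨lam, hl, fun mu hmu => hm hmu⟩
  have hfeas : ∃ lam I, Feas E lam I := by
    obtain ⟨s⟩ := ‹Nonempty ι›
    refine ⟨Pi.single s (n + 2), (n + 2) • E s, ?_, ?_, ?_⟩
    · intro t
      by_cases h : t = s
      · subst h; simp; positivity
      · simp [h]
    · simp
    · intro i
      simp [Pi.single_apply]
  let T := (degLE n ((n + 2) * D)).filter fun I => ∃ lam, Feas E lam I
  have hT : ∀ lam I, Feas E lam I → I ∈ T := fun lam I h =>
    Finset.mem_filter.mpr ⟨(mem_degLE I).mpr (feas_degLE E hE h), lam, h⟩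
  choose! L hL1 hL2 using hI
  obtain ⟨I, hIT, hmin⟩ := T.exists_min_image (fun I => ∑ t, L I t * c t + y I)
    (by obtain ⟨lam, I, h⟩ := hfeas; exact ⟨I, hT lam I h⟩)
  refine ⟨L I, I, hL1 I (Finset.mem_filter.mp hIT).2, fun mu J h => ?_⟩
  have h1 := hmin J (hT mu J h)
  have h2 := hL2 J ⟨mu, h⟩ mu h
  linarith

lemma exists_good {ι : Type*} [Fintype ι] [Nonempty ι] {n D : ℕ} (E : ι → Exp n)
    (hE : ∀ t, expDeg (E t) ≤ D) (c : ι → ℝ) (y : Exp n → ℝ) :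
    ∃ lam I, Feas E lam I ∧
      (∀ mu J, Feas E mu J → ∑ t, mu t * c t + y J ≤ ∑ t, lam t * c t + y I →
        (∀ t, 0 < lam t → 0 < mu t) → ∀ t, 0 < mu t → 0 < lam t) ∧
      (∃ s, 1 < lam s) ∧
      ∃ (a : Fin n → ℝ) (κ : ℝ), (∀ t, κ ≤ c t + ∑ j, (E t j : ℝ) * a j) ∧
        ∀ t, 0 < lam t → c t + ∑ j, (E t j : ℝ) * a j = κ := by
  classical
  obtain ⟨lam0, I0, hf0, hmin⟩ := exists_opt E hE c y
  let supp : (ι → ℝ) → Finset ι := fun lam => Finset.univ.filter fun t => 0 < lam t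
  have hsupp : ∀ lam t, t ∈ supp lam ↔ 0 < lam t := fun lam t => by simp [supp]
  let T : Finset (Finset ι) := Finset.univ.filter fun S => ∃ lam I, Feas E lam I ∧
    ∑ t, lam t * c t + y I ≤ ∑ t, lam0 t * c t + y I0 ∧ supp lam = S
  obtain ⟨S, hS, hmax⟩ := T.exists_max_image Finset.card
    ⟨supp lam0, Finset.mem_filter.mpr ⟨Finset.mem_univ _, lam0, I0, hf0, le_rfl, rfl⟩⟩
  obtain ⟨-, lam, I, hf, hopt, rfl⟩ := Finset.mem_filter.mp hS
  obtain ⟨a, κ, ha1, ha2⟩ := exists_dual (fun t j => (E t j : ℝ)) c lam hf.1 (by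
    intro mu h0 h1 h2
    have := hmin mu I ⟨h0, h1.trans hf.2.1, fun i => (h2 i).trans (hf.2.2 i)⟩
    linarith)
  obtain ⟨mu, m0, m1, m2, m3, s, hs⟩ := exists_big (fun t j => (E t j : ℝ)) lam hf.1 hf.2.1
  have hmufeas : Feas E mu I := ⟨m0, m1, fun i => (m2 i).trans (hf.2.2 i)⟩
  have hval : ∀ nu : ι → ℝ, Feas E nu I → (∀ t, 0 < nu t → 0 < lam t) →
      ∑ t, nu t * c t = (n + 2) * κ - ∑ j, (I j : ℝ) * a j := by
    intro nu hnu hsub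
    have h1 : ∀ t, nu t * c t = nu t * κ - ∑ j, nu t * (E t j : ℝ) * a j := by
      intro t
      have : ∑ j, nu t * (E t j : ℝ) * a j = nu t * ∑ j, (E t j : ℝ) * a j := by
        rw [Finset.mul_sum]; exact Finset.sum_congr rfl fun i _ => by ring
      rw [this]
      rcases (hnu.1 t).eq_or_lt with h | h
      · rw [← h]; ring
      · rw [← ha2 t (hsub t h)]; ring
    simp only [h1]
    rw [Finset.sum_sub_distrib, ← Finset.sum_mul, hnu.2.1, Finset.sum_comm]
    congr 1
    refine Finset.sum_congr rfl fun j _ => ?_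
    rw [← Finset.sum_mul, hnu.2.2]
  set ε : ℝ := (mu s - 1) / (2 * mu s) with hε
  have hε0 : 0 < ε := div_pos (by linarith) (by linarith)
  have hε1 : ε < 1 := by
    rw [hε, div_lt_one (by linarith)]; linarith
  have hbig : 1 < (1 - ε) * mu s := by
    have : (1 - ε) * mu s = (mu s + 1) / 2 := by
      rw [hε]; field_simp; ring
    rw [this]; linarith
  let nu : ι → ℝ := fun t => (1 - ε) * mu t + ε * lam t
  have hnusum : ∀ g : ι → ℝ, ∑ t, nu t * g t =
      (1 - ε) * ∑ t, mu t * g t + ε * ∑ t, lam t * g t := by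
    intro g
    rw [Finset.mul_sum, Finset.mul_sum, ← Finset.sum_add_distrib]
    exact Finset.sum_congr rfl fun i _ => by simp only [nu]; ring
  have hnu0 : ∀ t, 0 ≤ nu t := fun t => add_nonneg (mul_nonneg (by linarith) (m0 t))
    (mul_nonneg hε0.le (hf.1 t))
  have hnuf : Feas E nu I := by
    refine ⟨hnu0, ?_, fun i => ?_⟩
    · have := hnusum (fun _ => 1)
      simp only [mul_one] at this
      rw [this, m1, hf.2.1]; ring
    · rw [hnusum, hmufeas.2.2 i, hf.2.2 i]; ring
  have hnulam : ∀ t, 0 < nu t ↔ 0 < lam t := by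
    intro t
    constructor
    · intro h
      by_contra hcon
      have h1 : lam t = 0 := le_antisymm (not_lt.mp hcon) (hf.1 t)
      have h2 : mu t = 0 := le_antisymm (not_lt.mp fun h' => hcon (m3 t h')) (m0 t)
      simp only [nu, h1, h2] at h
      linarith
    · intro h
      have h1 : 0 < ε * lam t := mul_pos hε0 h
      have h2 : 0 ≤ (1 - ε) * mu t := mul_nonneg (by linarith) (m0 t)
      simp only [nu]; linarith
  have hcost : ∑ t, nu t * c t = ∑ t, lam t * c t := by
    rw [hval nu hnuf fun t => (hnulam t).1, hval lam hf fun t => id]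
  refine ⟨nu, I, hnuf, ?_, ⟨s, ?_⟩, a, κ, ha1, fun t ht => ha2 t ((hnulam t).1 ht)⟩
  · intro rho J hrho hle hsub t ht
    have hmem : supp rho ∈ T := Finset.mem_filter.mpr ⟨Finset.mem_univ _, rho, J, hrho,
      by linarith, rfl⟩
    have hsubset : supp lam ⊆ supp rho := fun t ht =>
      (hsupp _ _).2 (hsub t ((hnulam t).2 ((hsupp _ _).1 ht)))
    have heq := Finset.eq_of_subset_of_card_le hsubset (hmax _ hmem)
    exact (hnulam t).2 ((hsupp _ _).1 (heq ▸ (hsupp _ _).2 ht))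
  · have : 0 ≤ ε * lam s := mul_nonneg hε0.le (hf.1 s)
    simp only [nu]; linarith

lemma sum_update_add {k : ℕ} {X : Fin k → Type} {M : Type*} [AddCommMonoid M]
    (G : ∀ j, X j → M) (s : ∀ j, X j) (j : Fin k) (x : X j) :
    ∑ i, G i (Function.update s j x i) + G j (s j) = ∑ i, G i (s i) + G j x := by
  rw [← Finset.add_sum_erase _ _ (Finset.mem_univ j),
    ← Finset.add_sum_erase Finset.univ (fun i => G i (s i)) (Finset.mem_univ j)]
  have : ∑ i ∈ Finset.univ.erase j, G i (Function.update s j x i) =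
      ∑ i ∈ Finset.univ.erase j, G i (s i) :=
    Finset.sum_congr rfl fun i hi => by
      rw [Function.update_of_ne (Finset.ne_of_mem_erase hi)]
  rw [this, Function.update_self]
  abel

lemma expDeg_add {n : ℕ} (I J : Exp n) : expDeg (I + J) = expDeg I + expDeg J := by
  simp [expDeg, Finset.sum_add_distrib]

lemma expDeg_sum {n : ℕ} {α : Type*} (S : Finset α) (g : α → Exp n) :
    expDeg (∑ i ∈ S, g i) = ∑ i ∈ S, expDeg (g i) := by
  simp only [expDeg, Finset.sum_apply]
  exact Finset.sum_comm

theorem core {n k : ℕ} (X : Fin k → Type) [∀ j, Fintype (X j)] [∀ j, Nonempty (X j)]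
    (ex : ∀ j, X j → Exp n) (co : ∀ j, X j → ℝ) (d : Fin k → ℕ)
    (hd : ∀ j x, expDeg (ex j x) ≤ d j) (R : ∀ j, X j → X j → Prop) (y : Exp n → ℝ)
    (hex : ∀ j (x : X j) J, expDeg J + d j ≤ (n + 2) * ∑ j, d j →
      ∃ x', R j x x' ∧ co j x' + y (J + ex j x') ≤ co j x + y (J + ex j x)) :
    ∃ (a : Fin n → ℝ) (s : ∀ j, X j), ∀ j,
      (∀ x, co j (s j) + ∑ i, (ex j (s j) i : ℝ) * a i ≤ co j x + ∑ i, (ex j x i : ℝ) * a i) ∧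
      ∃ x', R j (s j) x' ∧
        co j (s j) + ∑ i, (ex j (s j) i : ℝ) * a i = co j x' + ∑ i, (ex j x' i : ℝ) * a i := by
  classical
  let E : (∀ j, X j) → Exp n := fun t => ∑ j, ex j (t j)
  let c : (∀ j, X j) → ℝ := fun t => ∑ j, co j (t j)
  have hE : ∀ t, expDeg (E t) ≤ ∑ j, d j := fun t => by
    rw [expDeg_sum]
    exact Finset.sum_le_sum fun j _ => hd j _
  obtain ⟨lam, I, hf, hmax, ⟨s, hs⟩, a, κ, ha1, ha2⟩ := exists_good E hE c y
  refine ⟨a, s, fun j => ?_⟩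
  have upE : ∀ x, E (Function.update s j x) + ex j (s j) = E s + ex j x :=
    fun x => sum_update_add ex s j x
  have upc : ∀ x, c (Function.update s j x) + co j (s j) = c s + co j x :=
    fun x => sum_update_add co s j x
  have upEi : ∀ x i, (E (Function.update s j x) i : ℝ) + ex j (s j) i = E s i + ex j x i := by
    intro x i
    have := congrFun (upE x) i
    simp only [Pi.add_apply] at this
    exact_mod_cast this
  have upv : ∀ x, (c (Function.update s j x) + ∑ i, (E (Function.update s j x) i : ℝ) * a i) +
      (co j (s j) + ∑ i, (ex j (s j) i : ℝ) * a i) =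
      (c s + ∑ i, (E s i : ℝ) * a i) + (co j x + ∑ i, (ex j x i : ℝ) * a i) := by
    intro x
    have h1 : ∑ i, (E (Function.update s j x) i : ℝ) * a i + ∑ i, (ex j (s j) i : ℝ) * a i =
        ∑ i, (E s i : ℝ) * a i + ∑ i, (ex j x i : ℝ) * a i := by
      rw [← Finset.sum_add_distrib, ← Finset.sum_add_distrib]
      exact Finset.sum_congr rfl fun i _ => by rw [← add_mul, ← add_mul, upEi]
    linarith [upc x]
  have hs0 : 0 < lam s := by linarith
  have hκ := ha2 s hs0
  refine ⟨fun x => ?_, ?_⟩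
  · have h1 := ha1 (Function.update s j x)
    have h2 := upv x
    linarith
  · have hIs : ∀ i, E s i ≤ I i := by
      intro i
      have h1 : (E s i : ℝ) ≤ I i := by
        rw [← hf.2.2 i]
        have h2 := Finset.single_le_sum (f := fun t => lam t * (E t i : ℝ))
          (fun t _ => mul_nonneg (hf.1 t) (Nat.cast_nonneg _)) (Finset.mem_univ s)
        have h3 : (0 : ℝ) ≤ E s i := Nat.cast_nonneg _
        nlinarith
      exact_mod_cast h1
    have hexE : ∀ i, ex j (s j) i ≤ E s i := by
      intro i
      simp only [E, Finset.sum_apply]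
      exact Finset.single_le_sum (f := fun j => ex j (s j) i) (fun _ _ => Nat.zero_le _)
        (Finset.mem_univ j)
    let Q : Exp n := I - E s
    have hQ : Q + E s = I := by
      funext i; simp only [Q, Pi.add_apply, Pi.sub_apply]; have := hIs i; omega
    let J : Exp n := Q + (E s - ex j (s j))
    have hJ : J + ex j (s j) = I := by
      rw [← hQ]
      funext i; simp only [J, Pi.add_apply, Pi.sub_apply]; have := hexE i; omega
    have hQdeg : expDeg Q ≤ (n + 1) * ∑ j, d j := by
      have hq : (expDeg Q : ℝ) ≤ ((n + 1) * ∑ j, d j : ℝ) := by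
        have hQi : ∀ i, (Q i : ℝ) = ∑ t, (lam t - Pi.single (M := fun _ => ℝ) s 1 t) * (E t i : ℝ) := by
          intro i
          simp only [sub_mul, Finset.sum_sub_distrib, hf.2.2 i]
          have h1 : Q i + E s i = I i := congrFun hQ i
          have h2 : (Q i : ℝ) + E s i = I i := by exact_mod_cast h1
          simp [Pi.single_apply]
          linarith
        have hw0 : ∀ t, 0 ≤ lam t - Pi.single (M := fun _ => ℝ) s 1 t := by
          intro t
          by_cases h : t = s
          · subst h; simp; linarith
          · simp [h, hf.1 t]
        have hw1 : ∑ t, (lam t - Pi.single (M := fun _ => ℝ) s 1 t) = n + 1 := by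
          rw [Finset.sum_sub_distrib, hf.2.1]; simp; ring
        unfold expDeg
        push_cast
        simp only [hQi]
        rw [Finset.sum_comm, ← hw1, Finset.sum_mul]
        refine Finset.sum_le_sum fun t _ => ?_
        rw [← Finset.mul_sum]
        refine mul_le_mul_of_nonneg_left ?_ (hw0 t)
        exact_mod_cast hE t
      exact_mod_cast hq
    have hrest : expDeg (E s - ex j (s j)) + d j ≤ ∑ j, d j := by
      have h1 : E s - ex j (s j) = ∑ i ∈ Finset.univ.erase j, ex i (s i) := by
        have h2 := Finset.add_sum_erase Finset.univ (fun i => ex i (s i)) (Finset.mem_univ j)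
        have h3 : E s = ex j (s j) + ∑ i ∈ Finset.univ.erase j, ex i (s i) := h2.symm
        rw [h3]
        funext i; simp
      rw [h1, expDeg_sum, ← Finset.sum_erase_add Finset.univ d (Finset.mem_univ j)]
      gcongr
      exact hd _ _
    obtain ⟨x', hR, hle⟩ := hex j (s j) J (by
      have : expDeg J = expDeg Q + expDeg (E s - ex j (s j)) := expDeg_add _ _
      rw [this]
      nlinarith)
    rw [hJ] at hle
    set t := Function.update s j x' with ht
    let mu : (∀ j, X j) → ℝ := fun r => lam r - Pi.single (M := fun _ => ℝ) s 1 r +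
      Pi.single (M := fun _ => ℝ) t 1 r
    have hmusum : ∀ g : (∀ j, X j) → ℝ, ∑ r, mu r * g r = ∑ r, lam r * g r - g s + g t := by
      intro g
      simp only [mu, sub_mul, add_mul, Finset.sum_add_distrib, Finset.sum_sub_distrib]
      simp [Pi.single_apply]
    have hmu0 : ∀ r, 0 < lam r ∨ r = t → 0 < mu r := by
      intro r hr
      have h1 : (0 : ℝ) ≤ Pi.single (M := fun _ => ℝ) t 1 r := by
        by_cases h : r = t
        · subst h; simp
        · simp [h]
      by_cases h : r = s
      · subst h
        simp only [mu, Pi.single_eq_same]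
        linarith
      · rcases hr with hr | hr
        · simp only [mu, Pi.single_eq_of_ne h]; linarith
        · have := hf.1 r
          simp only [mu, Pi.single_eq_of_ne h]
          rw [hr, Pi.single_eq_same, ← hr]
          linarith
    have hmu0' : ∀ r, 0 ≤ mu r := by
      intro r
      rcases (hf.1 r).eq_or_lt with h | h
      · by_cases hrt : r = t
        · exact (hmu0 r (Or.inr hrt)).le
        · have hrs : r ≠ s := by rintro rfl; linarith
          simp [mu, ← h, hrt, hrs]
      · exact (hmu0 r (Or.inl h)).le
    have hmuf : Feas E mu (J + ex j x') := by
      refine ⟨hmu0', ?_, fun i => ?_⟩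
      · have := hmusum (fun _ => 1)
        simp only [mul_one] at this
        rw [this, hf.2.1]; ring
      · rw [hmusum (fun r => (E r i : ℝ)), hf.2.2 i, ← hJ]
        have := upEi x' i
        simp only [Pi.add_apply]
        push_cast
        linarith
    have htpos := hmax mu (J + ex j x') hmuf (by
      rw [hmusum c]
      have := upc x'
      linarith) (fun r hr => hmu0 r (Or.inl hr)) t (hmu0 t (Or.inr rfl))
    refine ⟨x', hR, ?_⟩
    have h1 := ha2 t htpos
    have h2 := upv x'
    rw [← ht] at h2
    linarith

lemma macVal_shift {n : ℕ} (f : TropPoly n) (J K : Exp n) (y : Exp n → ℝ) (hK : K ∈ f.supp) :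
    macVal f J (fun I => (y I : WithTop ℝ)) (J + K) = ((f.coeff K + y (J + K) : ℝ) : WithTop ℝ) := by
  have h : J + K - J = K := by funext i; simp
  have hle : J ≤ J + K := fun i => by simp
  unfold macVal shiftCoeff
  rw [if_pos ⟨hle, by rw [h]; exact hK⟩, h]
  rfl

lemma macMinLE_eq {n : ℕ} (f : TropPoly n) (J : Exp n) (y : Exp n → ℝ) (N : ℕ)
    (h : expDeg J + f.deg ≤ N) :
    macMinLE f J (fun I => (y I : WithTop ℝ)) N =
      ((f.supp.inf' f.supp_nonempty (fun K => f.coeff K + y (J + K)) : ℝ) : WithTop ℝ) := by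
  apply le_antisymm
  · obtain ⟨K, hK, hEq⟩ := Finset.exists_mem_eq_inf' f.supp_nonempty
      (fun K => f.coeff K + y (J + K))
    rw [hEq, ← macVal_shift f J K y hK]
    refine Finset.inf_le ((mem_degLE _).2 ?_)
    have h1 : expDeg K ≤ f.deg := Finset.le_sup (f := expDeg) hK
    rw [expDeg_add]
    omega
  · refine Finset.le_inf fun I _ => ?_
    by_cases hc : J ≤ I ∧ I - J ∈ f.supp
    · have hI : J + (I - J) = I := by
        funext i
        have : J i ≤ I i := hc.1 i
        simp only [Pi.add_apply, Pi.sub_apply]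
        omega
      have h1 := macVal_shift f J (I - J) y hc.2
      rw [hI] at h1
      rw [h1, WithTop.coe_le_coe]
      have h2 := Finset.inf'_le (fun K => f.coeff K + y (J + K)) hc.2
      simp only [hI] at h2
      exact h2
    · unfold macVal shiftCoeff
      rw [if_neg hc, top_add]
      exact le_top

/-- The two sides of a min-plus polynomial. -/
def side {n : ℕ} (p : TropPoly n × TropPoly n) : Bool → TropPoly n
  | true => p.1
  | false => p.2

lemma side_deg {n : ℕ} (p : TropPoly n × TropPoly n) (b : Bool) :
    (side p b).deg ≤ max p.1.deg p.2.deg := by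
  cases b
  · exact le_max_right _ _
  · exact le_max_left _ _

/-- **Min-plus dual Nullstellensatz over ℝ** : a system `F = {(f_1,g_1), …, (f_k,g_k)}`
of min-plus polynomials in `n` variables over `ℝ` has a root iff the Macaulay min-plus
linear system `Ml_N ⊙ y = Mr_N ⊙ y` with `N = (n+2)(d_1 + ⋯ + d_k)` has a solution. -/
theorem minplus_dual_nullstellensatz_real (n k : ℕ) (hk : 1 ≤ k)
    (F : Fin k → TropPoly n × TropPoly n) :
    (∃ a : Fin n → ℝ, ∀ j : Fin k, (F j).1.eval a = (F j).2.eval a) ↔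
      (∃ y : Exp n → ℝ,
        IsMPMacaulaySol F ((n + 2) * ∑ j, max (F j).1.deg (F j).2.deg) y) := by
  constructor
  · rintro ⟨a, ha⟩
    refine ⟨fun I => ∑ i, (I i : ℝ) * a i, fun j J hJ => ?_⟩
    have key : ∀ f : TropPoly n, f.supp.inf' f.supp_nonempty
        (fun K => f.coeff K + ∑ i, (((J + K) i : ℕ) : ℝ) * a i) =
        f.eval a + ∑ i, (J i : ℝ) * a i := by
      intro f
      have h1 : ∀ K, f.coeff K + ∑ i, (((J + K) i : ℕ) : ℝ) * a i =
          f.mono K a + ∑ i, (J i : ℝ) * a i := by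
        intro K
        simp only [TropPoly.mono, Pi.add_apply, Nat.cast_add, add_mul, Finset.sum_add_distrib]
        ring
      simp only [h1]
      apply le_antisymm
      · obtain ⟨K, hK, hEq⟩ := Finset.exists_mem_eq_inf' f.supp_nonempty (fun K => f.mono K a)
        have h2 := Finset.inf'_le (fun K => f.mono K a + ∑ i, (J i : ℝ) * a i) hK
        unfold TropPoly.eval
        rw [hEq]
        exact h2
      · refine Finset.le_inf' _ _ fun K hK => ?_
        have h2 : f.eval a ≤ f.mono K a := Finset.inf'_le (fun K => f.mono K a) hK
        linarith
    rw [macMinLE_eq _ _ _ _ (by have := le_max_left (F j).1.deg (F j).2.deg; omega),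
      macMinLE_eq _ _ _ _ (by have := le_max_right (F j).1.deg (F j).2.deg; omega),
      key, key, ha j]
  · rintro ⟨y, hy⟩
    haveI : ∀ j, Nonempty (Σ b : Bool, {I // I ∈ (side (F j) b).supp}) := fun j => by
      obtain ⟨I, hI⟩ := (side (F j) true).supp_nonempty
      exact ⟨⟨true, I, hI⟩⟩
    obtain ⟨a, s, hs⟩ := core (fun j => Σ b : Bool, {I // I ∈ (side (F j) b).supp})
      (fun j x => x.2.1) (fun j x => (side (F j) x.1).coeff x.2.1)
      (fun j => max (F j).1.deg (F j).2.deg)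
      (fun j x => le_trans (Finset.le_sup (f := expDeg) x.2.2) (side_deg (F j) x.1))
      (fun j x x' => x'.1 = !x.1) y (by
        rintro j ⟨b, I, hI⟩ J hJ
        have h1 : ∀ b b' : Bool, (side (F j) b).supp.inf' (side (F j) b).supp_nonempty
            (fun K => (side (F j) b).coeff K + y (J + K)) =
            (side (F j) b').supp.inf' (side (F j) b').supp_nonempty
            (fun K => (side (F j) b').coeff K + y (J + K)) := by
          have h2 := hy j J hJ
          rw [macMinLE_eq _ _ _ _ (by have := le_max_left (F j).1.deg (F j).2.deg; omega),
            macMinLE_eq _ _ _ _ (by have := le_max_right (F j).1.deg (F j).2.deg; omega),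
            WithTop.coe_inj] at h2
          intro b b'
          cases b <;> cases b'
          · rfl
          · exact h2.symm
          · exact h2
          · rfl
        obtain ⟨K, hK, hEq⟩ := Finset.exists_mem_eq_inf' (side (F j) (!b)).supp_nonempty
          (fun K => (side (F j) (!b)).coeff K + y (J + K))
        refine ⟨⟨!b, K, hK⟩, rfl, ?_⟩
        have h3 := Finset.inf'_le (fun K => (side (F j) b).coeff K + y (J + K)) hI
        rw [h1 b (!b), hEq] at h3
        exact h3)
    refine ⟨a, fun j => ?_⟩
    obtain ⟨hmin, x', hx', heq⟩ := hs j
    generalize s j = x at hmin hx' heq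
    obtain ⟨b, I, hI⟩ := x
    obtain ⟨b', I', hI'⟩ := x'
    simp only at hx' heq hmin
    subst hx'
    have hge : ∀ c : Bool, (side (F j) b).mono I a ≤ (side (F j) c).eval a := fun c =>
      Finset.le_inf' _ _ fun K hK => hmin ⟨c, K, hK⟩
    have h1 : (side (F j) b).eval a = (side (F j) b).mono I a :=
      le_antisymm (Finset.inf'_le (fun K => (side (F j) b).mono K a) hI) (hge b)
    have h2 : (side (F j) (!b)).eval a = (side (F j) b).mono I a := by
      refine le_antisymm ?_ (hge _)
      have h3 : (side (F j) b).mono I a = (side (F j) (!b)).mono I' a := heq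
      rw [h3]
      exact Finset.inf'_le (fun K => (side (F j) (!b)).mono K a) hI'
    have h3 := h1.trans h2.symm
    cases b
    · exact h3.symm
    · exact h3
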